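/- Let c ≥ 1 and let P_1, …, P_c be N×N complex matrices that are Hermitian idempotents (orthogonal projections), pairwise orthogonal (P_i P_j = 0 for i ≠ j), and sum to the identity matrix. Let ω = exp(2πi/c) and U = Σ_{l=1}^c ω^l P_l. Let A be an N×N Hermitian complex matrix with P_k A P_k = 0 for all k = 1, …, c, and let D be an N×N Hermitian complex matrix commuting with every P_k. Then A = (c−1)·D − Σ_{k=1}^{c−1} U^k (D + A) (U^*)^k. -/

import Mathlib

open Matrix

/-- Powers of a linear combination of pairwise orthogonal idempotents summing to one. -/
theorem sum_smul_pow_of_orthogonal_idempotents {ι K R : Type*} [Fintype ι] [CommSemiring K]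
    [Semiring R] [Algebra K R] (P : ι → R) (hidem : ∀ i, P i * P i = P i)
    (horth : ∀ i j, i ≠ j → P i * P j = 0) (hsum : ∑ i, P i = 1) (a : ι → K) (k : ℕ) :
    (∑ i, a i • P i) ^ k = ∑ i, a i ^ k • P i := by
  induction k with
  | zero => simp [hsum]
  | succ k ih =>
    rw [pow_succ, ih, Finset.sum_mul_sum]
    refine Finset.sum_congr rfl fun i _ => ?_
    rw [Finset.sum_eq_single i]
    · rw [smul_mul_smul_comm, hidem, pow_succ]
    · intro j _ hj
      rw [smul_mul_smul_comm, horth i j hj.symm, smul_zero]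
    · simp

/-- Orthogonality of the powers of a primitive root of unity of order `c`. -/
theorem IsPrimitiveRoot.sum_range_pow_mul_inv_pow {K : Type*} [Field K] {ω : K} {c : ℕ}
    (h : IsPrimitiveRoot ω c) (l m : Fin c) :
    ∑ k ∈ Finset.range c, (ω ^ ((l : ℕ) + 1)) ^ k * ((ω⁻¹) ^ ((m : ℕ) + 1)) ^ k =
      if l = m then (c : K) else 0 := by
  have hω : ω ≠ 0 := h.ne_zero (Nat.ne_of_gt l.pos)
  simp only [← mul_pow]
  split_ifs with hlm
  · subst hlm
    simp [hω]
  · have hne : ω ^ ((l : ℕ) + 1) * (ω⁻¹) ^ ((m : ℕ) + 1) ≠ 1 := by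
      intro heq
      rw [inv_pow, mul_inv_eq_one₀ (pow_ne_zero _ hω), pow_succ, pow_succ] at heq
      exact hlm (Fin.ext (h.pow_inj l.isLt m.isLt (mul_right_cancel₀ hω heq)))
    rw [geom_sum_eq hne, mul_pow, ← pow_mul, ← pow_mul, mul_comm _ c, mul_comm _ c, pow_mul,
      pow_mul, inv_pow, h.pow_eq_one]
    simp

/-- Summing the conjugations by the powers of `∑ ω ^ (l + 1) • P l` gives `c` times the pinching by `P`. -/
theorem sum_range_conj_pow_eq_pinching {K R : Type*} [Field K] [Ring R] [Algebra K R] {c : ℕ}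
    (P : Fin c → R) (hidem : ∀ i, P i * P i = P i)
    (horth : ∀ i j, i ≠ j → P i * P j = 0) (hsum : ∑ i, P i = 1) {ω : K}
    (hω : IsPrimitiveRoot ω c) (M : R) :
    ∑ k ∈ Finset.range c, (∑ l : Fin c, ω ^ ((l : ℕ) + 1) • P l) ^ k * M *
        (∑ l : Fin c, (ω⁻¹) ^ ((l : ℕ) + 1) • P l) ^ k =
      (c : K) • ∑ l, P l * M * P l := by
  simp only [sum_smul_pow_of_orthogonal_idempotents P hidem horth hsum, Finset.sum_mul,
    Finset.mul_sum, smul_mul_assoc, mul_smul_comm, smul_smul, Finset.smul_sum]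
  rw [Finset.sum_comm]
  refine Finset.sum_congr rfl fun l _ => ?_
  rw [Finset.sum_comm]
  simp only [← Finset.sum_smul, mul_comm ((ω⁻¹ ^ _) ^ _), hω.sum_range_pow_mul_inv_pow, ite_smul,
    zero_smul, Finset.sum_ite_eq', Finset.mem_univ, if_true]

/-- Identity from the proof of Theorem 4.5 (edge-number bound): if `A` is
compressed to zero by a `c`-quantum coloring and `D` commutes with each
projection, then `A = (c-1)·D − ∑_{k=1}^{c-1} U^k (D+A) (U^*)^k`. -/
theorem edge_bound_identity (c N : ℕ) (hc : 1 ≤ c)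
    (P : Fin c → Matrix (Fin N) (Fin N) ℂ)
    (hherm : ∀ k, (P k).IsHermitian)
    (hidem : ∀ k, P k * P k = P k)
    (horth : ∀ k l, k ≠ l → P k * P l = 0)
    (hsum : ∑ k, P k = 1)
    (ω : ℂ) (hω : ω = Complex.exp (2 * Real.pi * Complex.I / c))
    (U : Matrix (Fin N) (Fin N) ℂ)
    (hU : U = ∑ l : Fin c, ω ^ ((l : ℕ) + 1) • P l)
    (A : Matrix (Fin N) (Fin N) ℂ) (hA : A.IsHermitian)
    (hcolor : ∀ k, P k * A * P k = 0)
    (D : Matrix (Fin N) (Fin N) ℂ) (hD : D.IsHermitian)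
    (hDcomm : ∀ k, D * P k = P k * D) :
    A = (c - 1 : ℂ) • D - ∑ k ∈ Finset.Icc 1 (c - 1), U ^ k * (D + A) * Uᴴ ^ k := by
  have hprim : IsPrimitiveRoot ω c := hω ▸ Complex.isPrimitiveRoot_exp c (by omega)
  have hstar : star ω = ω⁻¹ :=
    (Complex.inv_eq_conj (hprim.norm'_eq_one (by omega))).symm
  have hUstar : Uᴴ = ∑ l : Fin c, (ω⁻¹) ^ ((l : ℕ) + 1) • P l := by
    simp only [hU, conjTranspose_sum, conjTranspose_smul, star_pow, hstar, (hherm _).eq]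
  have hpinch : ∑ l, P l * (D + A) * P l = D := by
    simp only [mul_add, add_mul, hcolor, add_zero, ← hDcomm, mul_assoc, hidem]
    rw [← Finset.mul_sum, hsum, mul_one]
  have hfull := sum_range_conj_pow_eq_pinching P hidem horth hsum hprim (D + A)
  rw [← hU, ← hUstar, hpinch, Finset.range_eq_Ico, Finset.sum_eq_sum_Ico_succ_bot (by omega)]
    at hfull
  have hIcc : Finset.Icc 1 (c - 1) = Finset.Ico (0 + 1) c := by
    ext k
    simp only [Finset.mem_Icc, Finset.mem_Ico]
    omega
  rw [hIcc, sub_smul, ← hfull]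
  simp only [pow_zero, one_mul, mul_one, one_smul]
  abel
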